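/- For every point of the form (0, y, z) with y ≥ 0, z ≥ 0, the real number a1 is an eigenvalue of the Jacobian matrix J(0,y,z) of the vector field F. Consequently each of the equilibria E_0 = (0,0,0), E_1 = (0,0,a3·k2/c3), E_2 = (0,a2·k2/c2,0) and E_3 = (0,y_3,z_3) has the positive eigenvalue a1 and is unstable. -/

import Mathlib

/-- The eco-epidemic vector field `F` on `ℝ³`. -/
noncomputable def ecoField (a1 a2 a3 b1 c1 c2 c3 k1 k2 θ p : ℝ)
    (v : Fin 3 → ℝ) : Fin 3 → ℝ :=
  ![a1 * v 0 - b1 * (v 0) ^ 2 - c1 * (v 0) ^ 2 * v 1 / (k1 + (v 0) ^ 2)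
      - p * c1 * (v 0) ^ 2 * v 2 / (k1 + (v 0) ^ 2),
    a2 * v 1 - c2 * v 1 * (v 1 + v 2) / (k2 + v 0) - θ * v 1 * v 2,
    θ * v 1 * v 2 + a3 * v 2 - c3 * v 2 * (v 1 + v 2) / (k2 + v 0)]

/-- The Jacobian matrix of the eco-epidemic vector field at a point. -/
noncomputable def ecoJacobian (a1 a2 a3 b1 c1 c2 c3 k1 k2 θ p : ℝ)
    (pt : Fin 3 → ℝ) : Matrix (Fin 3) (Fin 3) ℝ :=
  fun i j =>
    fderiv ℝ (fun v => ecoField a1 a2 a3 b1 c1 c2 c3 k1 k2 θ p v i) pt (Pi.single j 1)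

/-- The first row of the Jacobian on the plane `x = 0` is `(a1, 0, 0)`. -/
theorem ecoField_hasFDerivAt_zero (a1 a2 a3 b1 c1 c2 c3 k1 k2 θ p y z : ℝ) (hk1 : 0 < k1) :
    HasFDerivAt (fun v => ecoField a1 a2 a3 b1 c1 c2 c3 k1 k2 θ p v 0)
      (a1 • (ContinuousLinearMap.proj 0 : (Fin 3 → ℝ) →L[ℝ] ℝ)) ![0, y, z] := by
  have h0 : HasFDerivAt (fun v : Fin 3 → ℝ => v 0)
      (ContinuousLinearMap.proj 0 : (Fin 3 → ℝ) →L[ℝ] ℝ) ![0, y, z] :=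
    (ContinuousLinearMap.proj 0 : (Fin 3 → ℝ) →L[ℝ] ℝ).hasFDerivAt
  have hg : DifferentiableAt ℝ (fun v : Fin 3 → ℝ =>
      b1 + c1 * (v 1 + p * v 2) / (k1 + (v 0) ^ 2)) ![0, y, z] := by
    have hne : k1 + ((![0, y, z] : Fin 3 → ℝ) 0) ^ 2 ≠ 0 := by positivity
    fun_prop (disch := exact hne)
  have h := (h0.const_mul a1).sub (h0.mul (h0.mul hg.hasFDerivAt))
  refine (h.congr_fderiv ?_).congr_of_eventuallyEq (Filter.Eventually.of_forall ?_)
  · ext v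
    simp
  · intro v
    have hne : k1 + (v 0) ^ 2 ≠ 0 := by positivity
    simp [ecoField]
    field_simp
    ring

theorem eco_eigen (a1 a2 a3 b1 c1 c2 c3 k1 k2 θ p y z : ℝ) (hk1 : 0 < k1) :
    ∃ v : Fin 3 → ℝ, v ≠ 0 ∧
      (ecoJacobian a1 a2 a3 b1 c1 c2 c3 k1 k2 θ p ![0, y, z]).mulVec v = a1 • v := by
  have hdet : (ecoJacobian a1 a2 a3 b1 c1 c2 c3 k1 k2 θ p ![0, y, z]
      - a1 • (1 : Matrix (Fin 3) (Fin 3) ℝ)).det = 0 := by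
    apply Matrix.det_eq_zero_of_row_eq_zero 0
    intro j
    have h := (ecoField_hasFDerivAt_zero a1 a2 a3 b1 c1 c2 c3 k1 k2 θ p y z hk1).fderiv
    simp only [Matrix.sub_apply, ecoJacobian, h]
    fin_cases j <;> simp
  obtain ⟨v, hv, h⟩ := Matrix.exists_mulVec_eq_zero_iff.mpr hdet
  refine ⟨v, hv, ?_⟩
  rw [Matrix.sub_mulVec, Matrix.smul_mulVec, Matrix.one_mulVec, sub_eq_zero] at h
  exact h

/-- At any point of the plane `x = 0`, `a1` is an eigenvalue of the Jacobian; in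
particular the equilibria `E0`, `E1`, `E2`, `E3` all have the positive eigenvalue `a1`. -/
theorem a1_eigenvalue_on_x_eq_zero_plane
    (a1 a2 a3 b1 c1 c2 c3 k1 k2 θ p : ℝ)
    (ha1 : 0 < a1) (ha2 : 0 < a2) (ha3 : 0 < a3) (hb1 : 0 < b1)
    (hc1 : 0 < c1) (hc2 : 0 < c2) (hc3 : 0 < c3)
    (hk1 : 0 < k1) (hk2 : 0 < k2) (hθ : 0 < θ) (hp : 0 < p) (hp1 : p ≤ 1) :
    (∀ y z : ℝ, 0 ≤ y → 0 ≤ z →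
      ∃ v : Fin 3 → ℝ, v ≠ 0 ∧
        (ecoJacobian a1 a2 a3 b1 c1 c2 c3 k1 k2 θ p ![0, y, z]).mulVec v = a1 • v) ∧
    0 < a1 ∧
    (∃ v : Fin 3 → ℝ, v ≠ 0 ∧
      (ecoJacobian a1 a2 a3 b1 c1 c2 c3 k1 k2 θ p ![0, 0, 0]).mulVec v = a1 • v) ∧
    (∃ v : Fin 3 → ℝ, v ≠ 0 ∧
      (ecoJacobian a1 a2 a3 b1 c1 c2 c3 k1 k2 θ p ![0, 0, a3 * k2 / c3]).mulVec v = a1 • v) ∧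
    (∃ v : Fin 3 → ℝ, v ≠ 0 ∧
      (ecoJacobian a1 a2 a3 b1 c1 c2 c3 k1 k2 θ p ![0, a2 * k2 / c2, 0]).mulVec v = a1 • v) ∧
    (∃ v : Fin 3 → ℝ, v ≠ 0 ∧
      (ecoJacobian a1 a2 a3 b1 c1 c2 c3 k1 k2 θ p
        ![0, (-a3 * k2 * θ + a2 * c3 - a3 * c2) / (θ * (k2 * θ + c2 - c3)),
            -((-a2 * k2 * θ + a2 * c3 - a3 * c2) / (θ * (k2 * θ + c2 - c3)))]).mulVec v
        = a1 • v) := by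
  have key := fun y z => eco_eigen a1 a2 a3 b1 c1 c2 c3 k1 k2 θ p y z hk1
  exact ⟨fun y z _ _ => key y z, ha1, key _ _, key _ _, key _ _, key _ _⟩
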